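/- Let n ≥ 2 and q > 0. There exists a constant C > 0 depending only on n and q such that for every ε ∈ (0, 1/2), ∫_{S^{n−1}} (ε²|x'|² + x_n²)^{−q/2} dx ≤ C·G(ε), where G(ε) = 1 if 0 < q < 1, G(ε) = |log ε| if q = 1, and G(ε) = ε^{1−q} if q > 1. -/

import Mathlib

open MeasureTheory Metric Real
open scoped ENNReal Topology

noncomputable section

/-- The standard surface measure on the unit sphere `S^{n-1} ⊆ ℝⁿ`,
viewed as a measure on the ambient space `ℝⁿ` supported on the sphere. -/
def sphereMeasure (n : ℕ) : Measure (EuclideanSpace ℝ (Fin n)) :=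
  Measure.map Subtype.val ((volume : Measure (EuclideanSpace ℝ (Fin n))).toSphere)

/-- The last coordinate `x_n` of a point `x ∈ ℝⁿ`. -/
def lastCoord {n : ℕ} (x : EuclideanSpace ℝ (Fin n)) : ℝ :=
  if h : n = 0 then 0 else x ⟨n - 1, Nat.sub_lt (Nat.pos_of_ne_zero h) one_pos⟩

/-- The Euclidean norm `|x'|` of the vector of first `n-1` coordinates of `x ∈ ℝⁿ`. -/
def primeNorm {n : ℕ} (x : EuclideanSpace ℝ (Fin n)) : ℝ :=
  Real.sqrt (∑ i : Fin n, if (i : ℕ) < n - 1 then x i ^ 2 else 0)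

lemma volume_slab_le (m : ℕ) (r : ℝ) (hr : 0 ≤ r) :
    volume {y : EuclideanSpace ℝ (Fin (m + 1)) |
      ∀ i, |y i| ≤ if i = Fin.last m then r else 1} ≤ ENNReal.ofReal (2 ^ (m + 1) * r) := by
  set c : Fin (m + 1) → ℝ := fun i => if i = Fin.last m then r else 1 with hc
  have hset : {y : EuclideanSpace ℝ (Fin (m + 1)) | ∀ i, |y i| ≤ c i} =
      (@WithLp.ofLp 2 (Fin (m + 1) → ℝ)) ⁻¹' Set.Icc (-c) c := by
    ext y
    simp only [Set.mem_ofPred_eq, Set.mem_preimage, Set.mem_Icc, Pi.le_def, abs_le, Pi.neg_apply,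
      forall_and]
  rw [hset, (PiLp.volume_preserving_ofLp (Fin (m + 1))).measure_preimage
    measurableSet_Icc.nullMeasurableSet, Real.volume_Icc_pi,
    ← ENNReal.ofReal_prod_of_nonneg]
  · apply ENNReal.ofReal_le_ofReal
    have : ∀ i, c i - (-c) i = 2 * c i := fun i => by simp only [Pi.neg_apply]; ring
    simp only [this, Finset.prod_mul_distrib]
    simp [hc]
  · intro i _
    simp only [hc, Pi.neg_apply]
    split_ifs <;> linarith

lemma lastCoord_succ {m : ℕ} (x : EuclideanSpace ℝ (Fin (m + 1))) :
    lastCoord x = x (Fin.last m) := by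
  simp [lastCoord, Fin.last]

lemma primeNorm_sq_add_lastCoord_sq {m : ℕ} (x : EuclideanSpace ℝ (Fin (m + 1))) :
    primeNorm x ^ 2 + lastCoord x ^ 2 = ‖x‖ ^ 2 := by
  rw [lastCoord_succ, primeNorm, Real.sq_sqrt, EuclideanSpace.real_norm_sq_eq,
    Fin.sum_univ_castSucc, Fin.sum_univ_castSucc]
  · simp
  · exact Finset.sum_nonneg fun i _ => by split_ifs <;> positivity

/-- The band `|x_n| ≤ r` of the sphere has surface measure `O(r)`. -/
lemma toSphere_band_le (m : ℕ) (r : ℝ) (hr : 0 ≤ r) :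
    ((volume : Measure (EuclideanSpace ℝ (Fin (m + 1)))).toSphere).real
      {x | |lastCoord (x : EuclideanSpace ℝ (Fin (m + 1)))| ≤ r} ≤
      (m + 1) * 2 ^ (m + 1) * r := by
  have hmeas : MeasurableSet {x : sphere (0 : EuclideanSpace ℝ (Fin (m + 1))) 1 |
      |lastCoord (x : EuclideanSpace ℝ (Fin (m + 1)))| ≤ r} := by
    simp only [lastCoord_succ]
    apply measurableSet_le _ measurable_const
    exact Continuous.measurable (by fun_prop)
  rw [Measure.real, Measure.toSphere_apply' _ hmeas]
  apply ENNReal.toReal_le_of_le_ofReal (by positivity)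
  rw [mul_assoc, ENNReal.ofReal_mul (by positivity), finrank_euclideanSpace_fin]
  gcongr
  · rw [← Nat.cast_succ, ENNReal.ofReal_natCast]
  · refine le_trans (measure_mono ?_) (volume_slab_le m r hr)
    rintro _ ⟨t, ⟨ht0, ht1⟩, _, ⟨x, hx, rfl⟩, rfl⟩ i
    simp only [Set.mem_ofPred_eq, lastCoord_succ] at hx
    have hxi : |(x : EuclideanSpace ℝ (Fin (m + 1))) i| ≤ 1 := by
      have := PiLp.norm_apply_le (x : EuclideanSpace ℝ (Fin (m + 1))) i
      rwa [norm_eq_of_mem_sphere, Real.norm_eq_abs] at this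
    have key : |t * (x : EuclideanSpace ℝ (Fin (m + 1))) i| ≤
        |(x : EuclideanSpace ℝ (Fin (m + 1))) i| := by
      rw [abs_mul, abs_of_pos ht0]
      exact mul_le_of_le_one_left (abs_nonneg _) ht1.le
    change |t * (x : EuclideanSpace ℝ (Fin (m + 1))) i| ≤ _
    split_ifs with h
    · subst h; exact key.trans hx
    · exact key.trans hxi

/-- Layer-cake bound for a bounded function whose distribution function decays like a power. -/
lemma integral_le_of_meas_le_rpow {α : Type*} [MeasurableSpace α] (μ : Measure α)
    [IsFiniteMeasure μ] (f : α → ℝ) (hf : Measurable f) (hf0 : ∀ x, 0 ≤ f x) (T : ℝ) (hT : 1 ≤ T)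
    (hfT : ∀ x, f x ≤ T) (A p : ℝ)
    (h : ∀ t, 1 ≤ t → μ.real {x | t ≤ f x} ≤ A * t ^ p) :
    ∫ x, f x ∂μ ≤ μ.real Set.univ + A * ∫ t in (1 : ℝ)..T, t ^ p := by
  have hint : Integrable f μ := Integrable.of_bound hf.aestronglyMeasurable T
    (Filter.Eventually.of_forall fun x => by
      rw [Real.norm_eq_abs, abs_of_nonneg (hf0 x)]; exact hfT x)
  have hanti : Antitone fun t => μ.real {x | t ≤ f x} := fun s t hst =>
    measureReal_mono fun x hx => le_trans hst hx
  have hii : ∀ a b, IntervalIntegrable (fun t => μ.real {x | t ≤ f x}) volume a b :=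
    fun a b => (hanti.antitoneOn _).intervalIntegrable
  rw [hint.integral_eq_integral_Ioc_meas_le (Filter.Eventually.of_forall hf0)
    (Filter.Eventually.of_forall hfT), ← intervalIntegral.integral_of_le (by linarith),
    ← intervalIntegral.integral_add_adjacent_intervals (hii 0 1) (hii 1 T),
    ← intervalIntegral.integral_const_mul]
  refine add_le_add ?_ ?_
  · calc _ ≤ ∫ _ in (0 : ℝ)..1, μ.real Set.univ :=
          intervalIntegral.integral_mono_on zero_le_one (hii 0 1) (by simp)
            fun t _ => measureReal_mono (Set.subset_univ _)
      _ = _ := by simp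
  · refine intervalIntegral.integral_mono_on hT (hii 1 T) ?_ fun t ht => h t ht.1
    refine IntervalIntegrable.const_mul (intervalIntegral.intervalIntegrable_rpow (Or.inr ?_)) A
    exact Set.notMem_uIcc_of_lt one_pos (by linarith)

lemma exists_rpow_integral_growth_bound (q : ℝ) (hq : 0 < q) :
    ∃ C : ℝ, 0 < C ∧ ∀ ε : ℝ, 0 < ε → ε < 1 / 2 →
      1 ≤ C * (if q < 1 then 1 else if q = 1 then |Real.log ε| else ε ^ (1 - q)) ∧
      (∫ t in (1 : ℝ)..(ε ^ (-q)), t ^ (-(1 / q))) ≤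
        C * (if q < 1 then 1 else if q = 1 then |Real.log ε| else ε ^ (1 - q)) := by
  have hI : ∀ ε : ℝ, 0 < ε → q ≠ 1 → (∫ t in (1 : ℝ)..(ε ^ (-q)), t ^ (-(1 / q))) =
      (ε ^ (1 - q) - 1) / (1 - 1 / q) := by
    intro ε hε hq1
    rw [integral_rpow, Real.one_rpow, ← Real.rpow_mul hε.le]
    · congr 1
      · congr 2; field_simp; ring
      · ring
    · refine Or.inr ⟨?_, Set.notMem_uIcc_of_lt one_pos (by positivity)⟩
      intro h
      apply hq1
      field_simp at h
      linarith
  rcases lt_trichotomy q 1 with h | h | h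
  · have hd : 0 < 1 / q - 1 := by rw [sub_pos]; exact (one_lt_div hq).2 h
    refine ⟨1 + 1 / (1 / q - 1), by positivity, fun ε hε hε2 => ?_⟩
    simp only [if_pos h, mul_one]
    refine ⟨le_add_of_nonneg_right (by positivity), ?_⟩
    rw [hI ε hε h.ne, ← neg_div_neg_eq, neg_sub, neg_sub]
    have : 0 < ε ^ (1 - q) := by positivity
    have : (1 - ε ^ (1 - q)) / (1 / q - 1) ≤ 1 / (1 / q - 1) := by
      gcongr; linarith
    linarith
  · subst h
    have hl : 0 < Real.log 2 := Real.log_pos one_lt_two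
    refine ⟨1 + 1 / Real.log 2, by positivity, fun ε hε hε2 => ?_⟩
    have hle : Real.log 2 ≤ |Real.log ε| := by
      rw [abs_of_neg (Real.log_neg hε (by linarith)), ← Real.log_inv]
      apply Real.log_le_log two_pos
      rw [le_inv_comm₀ two_pos hε]
      linarith
    simp only [lt_irrefl, if_true, if_false]
    have h1 : 1 ≤ 1 / Real.log 2 * |Real.log ε| := by
      rw [one_div, inv_mul_eq_div]; exact (one_le_div hl).2 hle
    refine ⟨by linarith [abs_nonneg (Real.log ε)], ?_⟩
    have : (∫ t in (1 : ℝ)..(ε ^ (-1 : ℝ)), t ^ (-(1 / 1 : ℝ))) = |Real.log ε| := by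
      simp only [div_one, Real.rpow_neg_one]
      rw [integral_inv_of_pos one_pos (by positivity), div_one, Real.log_inv,
        abs_of_neg (Real.log_neg hε (by linarith))]
    rw [this]
    linarith
  · have hd : 0 < 1 - 1 / q := by rw [sub_pos]; exact (div_lt_one hq).2 h
    refine ⟨1 + 1 / (1 - 1 / q), by positivity, fun ε hε hε2 => ?_⟩
    simp only [if_neg h.not_gt, if_neg h.ne']
    have h1 : 1 ≤ ε ^ (1 - q) :=
      Real.one_le_rpow_of_pos_of_le_one_of_nonpos hε (by linarith) (by linarith)
    have h2 : 0 ≤ 1 / (1 - 1 / q) * ε ^ (1 - q) := by positivity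
    refine ⟨by linarith, ?_⟩
    rw [hI ε hε h.ne', sub_div, div_eq_mul_one_div (ε ^ (1 - q)), mul_comm (ε ^ (1 - q))]
    have : 0 < 1 / (1 - 1 / q) := by positivity
    linarith

/-- estimate (4.11) of the paper.
There is `C > 0` such that for every `ε ∈ (0, 1/2)`,
`∫_{S^{n-1}} (ε²|x'|² + x_n²)^{-q/2} dx ≤ C G(ε)`, where `G(ε) = 1` if `q < 1`,
`G(ε) = |log ε|` if `q = 1`, and `G(ε) = ε^{1-q}` if `q > 1`. -/
theorem sphere_integral_eps_upper_bound
    (n : ℕ) (hn : 2 ≤ n) (q : ℝ) (hq : 0 < q) :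
    ∃ C : ℝ, 0 < C ∧ ∀ ε : ℝ, 0 < ε → ε < 1 / 2 →
      (∫ x, (ε ^ 2 * primeNorm x ^ 2 + lastCoord x ^ 2) ^ (-(q / 2)) ∂(sphereMeasure n)) ≤
        C * (if q < 1 then 1 else if q = 1 then |Real.log ε| else ε ^ (1 - q)) := by
  obtain ⟨m, rfl⟩ : ∃ m, n = m + 1 := ⟨n - 1, by omega⟩
  obtain ⟨C₀, hC₀, hG⟩ := exists_rpow_integral_growth_bound q hq
  set σ := (volume : Measure (EuclideanSpace ℝ (Fin (m + 1)))).toSphere with hσ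
  set A : ℝ := (m + 1) * 2 ^ (m + 1) with hA
  have hA0 : 0 < A := by positivity
  have hM : 0 ≤ σ.real Set.univ := measureReal_nonneg
  refine ⟨(σ.real Set.univ + A) * C₀, by positivity, fun ε hε hε2 => ?_⟩
  obtain ⟨hG1, hG2⟩ := hG ε hε hε2
  rw [sphereMeasure, (MeasurableEmbedding.subtype_coe
    isClosed_sphere.measurableSet).integral_map, ← hσ]
  have hbase : ∀ x : sphere (0 : EuclideanSpace ℝ (Fin (m + 1))) 1,
      ε ^ 2 ≤ ε ^ 2 * primeNorm x.1 ^ 2 + lastCoord x.1 ^ 2 := by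
    intro x
    have h := primeNorm_sq_add_lastCoord_sq x.1
    rw [norm_eq_of_mem_sphere] at h
    nlinarith [mul_nonneg (show 0 ≤ 1 - ε ^ 2 by nlinarith) (sq_nonneg (lastCoord x.1))]
  have hε20 : 0 < ε ^ 2 := by positivity
  have hpow : (ε ^ 2) ^ (-(q / 2)) = ε ^ (-q) := by
    rw [← Real.rpow_natCast, ← Real.rpow_mul hε.le]
    congr 1; push_cast; ring
  have hmeas : Measurable fun x : sphere (0 : EuclideanSpace ℝ (Fin (m + 1))) 1 =>
      (ε ^ 2 * primeNorm x.1 ^ 2 + lastCoord x.1 ^ 2) ^ (-(q / 2)) := by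
    refine Measurable.pow_const ?_ _
    have : ∀ x : EuclideanSpace ℝ (Fin (m + 1)),
        primeNorm x ^ 2 = ‖x‖ ^ 2 - x (Fin.last m) ^ 2 := fun x => by
      rw [← primeNorm_sq_add_lastCoord_sq, lastCoord_succ]; ring
    simp only [this, lastCoord_succ]
    exact Continuous.measurable (by fun_prop)
  have hmain := integral_le_of_meas_le_rpow σ
    (fun x => (ε ^ 2 * primeNorm x.1 ^ 2 + lastCoord x.1 ^ 2) ^ (-(q / 2))) hmeas
    (fun x => by positivity) (ε ^ (-q))
    (Real.one_le_rpow_of_pos_of_le_one_of_nonpos hε (by linarith) (by linarith))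
    (fun x => by
      rw [← hpow]
      exact Real.rpow_le_rpow_of_nonpos hε20 (hbase x) (by linarith))
    A (-(1 / q)) (fun t ht => by
      have ht0 : 0 < t := by linarith
      refine le_trans (measureReal_mono fun x hx => ?_)
        (toSphere_band_le m (t ^ (-(1 / q))) (by positivity))
      simp only [Set.mem_ofPred_eq] at hx ⊢
      rw [← Real.le_rpow_inv_iff_of_neg (hε20.trans_le (hbase x)) ht0 (by linarith)] at hx
      apply abs_le_of_sq_le_sq _ (by positivity)
      have : (t ^ (-(1 / q))) ^ 2 = t ^ (-(q / 2))⁻¹ := by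
        rw [← Real.rpow_natCast, ← Real.rpow_mul ht0.le]
        congr 1; push_cast; field_simp
      rw [this]
      refine le_trans ?_ hx
      exact le_add_of_nonneg_left (by positivity))
  refine hmain.trans ?_
  rw [mul_assoc (_ + A), add_mul (σ.real Set.univ)]
  exact add_le_add (le_mul_of_one_le_right hM hG1) (mul_le_mul_of_nonneg_left hG2 hA0.le)
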